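/- Pairing with the exponential of the identity tensor is the PBW symmetrization map: for every homogeneous P ∈ S(g) of degree d, ⟨ι^d/d!, P⟩ = β(P) in U(g), and ⟨ι^e/e!, P⟩ = 0 for every e ≠ d; equivalently ⟨e^ι, P⟩ = β(P) for all P ∈ S(g), where e^ι is interpreted degree by degree. -/

import Mathlib

noncomputable section
set_option linter.unusedSectionVars false

variable {K : Type} [Field K] [CharZero K]
variable {m : ℕ}

/-- The pairing of the monomial `b*_{i₁}⋯b*_{i_k}` of `S(g*)` (exponent vector `α`) with the
monomial `b_{j₁}⋯b_{j_l}` of `S(g)` (exponent vector `γ`):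
`⟨φ₁⋯φ_k, x₁⋯x_k⟩ = Σ_{σ ∈ S_k} φ₁(x_{σ(1)})⋯φ_k(x_{σ(k)})`, and `0` if `k ≠ l`. -/
def pairMon (α γ : Fin m →₀ ℕ) : K :=
  if h : (Finsupp.toMultiset α).toList.length = (Finsupp.toMultiset γ).toList.length then
    ∑ σ : Equiv.Perm (Fin (Finsupp.toMultiset α).toList.length),
      ∏ i, (if (Finsupp.toMultiset α).toList.get i
              = (Finsupp.toMultiset γ).toList.get (Fin.cast h (σ i)) then (1 : K) else 0)
  else 0

/-- The pairing of a monomial of `S(g*)` with an arbitrary element of `S(g)`. -/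
def pairFn (α : Fin m →₀ ℕ) (P : MvPolynomial (Fin m) K) : K :=
  ∑ γ ∈ P.support, MvPolynomial.coeff γ P * pairMon α γ

/-- The pairing `⟨·,·⟩ : S(g*) × S(g) → K`, in the coordinates given by a basis of `g` and the
dual basis of `g*` (`X i` stands for `bᵢ*` in the first argument and for `bᵢ` in the second). -/
def pairS (p P : MvPolynomial (Fin m) K) : K :=
  ∑ α ∈ p.support, MvPolynomial.coeff α p * pairFn α P


variable {L : Type} [LieRing L] [LieAlgebra K L]

open scoped TensorProduct

/-- The pairing `S(g*) → (S(g) → K)` as a bundled bilinear map. -/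
def pairLin : MvPolynomial (Fin m) K →ₗ[K] MvPolynomial (Fin m) K →ₗ[K] K :=
  (MvPolynomial.basisMonomials (Fin m) K).constr K fun α =>
    (MvPolynomial.basisMonomials (Fin m) K).constr K fun γ => pairMon (K := K) α γ

/-- The bilinear map `S(g*) → U(g) → (S(g) → U(g))`, `(Π, u) ↦ (P ↦ ⟨Π, P⟩ • u)`. -/
def pairBilU : MvPolynomial (Fin m) K →ₗ[K] UniversalEnvelopingAlgebra K L →ₗ[K]
    (MvPolynomial (Fin m) K →ₗ[K] UniversalEnvelopingAlgebra K L) :=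
  LinearMap.mk₂ K (fun p u => (pairLin (K := K) (m := m) p).smulRight u)
    (fun p p' u => by
      refine LinearMap.ext fun P => ?_
      simp only [LinearMap.smulRight_apply, map_add, LinearMap.add_apply, add_smul])
    (fun c p u => by
      refine LinearMap.ext fun P => ?_
      simp only [LinearMap.smulRight_apply, map_smul, LinearMap.smul_apply, smul_assoc])
    (fun p u u' => by
      refine LinearMap.ext fun P => ?_
      simp only [LinearMap.smulRight_apply, LinearMap.add_apply, smul_add])
    (fun c p u => by
      refine LinearMap.ext fun P => ?_
      simp only [LinearMap.smulRight_apply, LinearMap.smul_apply]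
      rw [smul_comm])

/-- The pairing `(S(g*) ⊗ U(g)) × S(g) → U(g)` obtained by pairing the first tensor factor
against `S(g)`: `⟨Π ⊗ u, P⟩ = ⟨Π, P⟩ • u`. -/
def pairTensor :
    (MvPolynomial (Fin m) K ⊗[K] UniversalEnvelopingAlgebra K L) →ₗ[K]
      (MvPolynomial (Fin m) K →ₗ[K] UniversalEnvelopingAlgebra K L) :=
  TensorProduct.lift (pairBilU (K := K) (m := m) (L := L))

/-- The identity tensor `ι = Σᵢ bᵢ* ⊗ bᵢ`, viewed as an element of `S(g*) ⊗ U(g)`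
(`X i` stands for `bᵢ*`). -/
def iotaTensor (b : Module.Basis (Fin m) K L) :
    MvPolynomial (Fin m) K ⊗[K] UniversalEnvelopingAlgebra K L :=
  ∑ i, MvPolynomial.X i ⊗ₜ[K] UniversalEnvelopingAlgebra.ι K (b i)

/-- Symmetrization of the monomial with exponent vector `α`:
`(1/d!) Σ_{σ ∈ S_d} x_{σ(1)} ⋯ x_{σ(d)}` in `U(g)`. -/
def symmMonomial (b : Module.Basis (Fin m) K L) (α : Fin m →₀ ℕ) : UniversalEnvelopingAlgebra K L :=
  (((Finsupp.toMultiset α).toList.length.factorial : K))⁻¹ •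
    ∑ σ : Equiv.Perm (Fin (Finsupp.toMultiset α).toList.length),
      (List.ofFn fun j =>
        UniversalEnvelopingAlgebra.ι K (b ((Finsupp.toMultiset α).toList.get (σ j)))).prod

/-- The symmetrization map `β : S(g) → U(g)`. -/
def symmetrization (b : Module.Basis (Fin m) K L) (P : MvPolynomial (Fin m) K) :
    UniversalEnvelopingAlgebra K L :=
  ∑ α ∈ P.support, MvPolynomial.coeff α P • symmMonomial b α

/-- Two finite families with the same multiset of values differ by a reindexing. -/
theorem exists_equiv_of_map_univ_eq {A B C : Type*} [Fintype A] [Fintype B] (f : A → C)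
    (g : B → C)
    (h : (Finset.univ : Finset A).val.map f = (Finset.univ : Finset B).val.map g) :
    ∃ e : A ≃ B, ∀ a, g (e a) = f a := by
  classical
  have key : ∀ c, Fintype.card {a // f a = c} = Fintype.card {b // g b = c} := fun c => by
    have hc := congrArg (Multiset.count c) h
    rw [Multiset.count_map, Multiset.count_map] at hc
    rw [Fintype.card_subtype, Fintype.card_subtype]
    simpa only [Finset.card_def, Finset.filter_val, eq_comm] using hc
  exact ⟨Equiv.ofFiberEquiv fun c => Fintype.equivOfCardEq (key c),
    fun a => Equiv.ofFiberEquiv_map _ a⟩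

theorem map_univ_toList_get {C : Type*} (s : Multiset C) :
    (Finset.univ : Finset (Fin s.toList.length)).val.map s.toList.get = s := by
  rw [Fin.univ_val_map, List.ofFn_get, Multiset.coe_toList]

theorem length_toList_toMultiset (α : Fin m →₀ ℕ) :
    (Finsupp.toMultiset α).toList.length = α.degree := by
  rw [Multiset.length_toList, Finsupp.card_toMultiset]
  rfl

theorem pairMon_of_degree_ne {α γ : Fin m →₀ ℕ} (h : α.degree ≠ γ.degree) :
    pairMon (K := K) α γ = 0 := by
  rw [pairMon, dif_neg]
  simpa only [length_toList_toMultiset] using h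

/-- The pairing of two monomials, computed from arbitrary enumerations of their factors. -/
theorem pairMon_eq_sum_perm {n : ℕ} {α γ : Fin m →₀ ℕ} (f c : Fin n → Fin m)
    (hf : Finsupp.toMultiset α = Finset.univ.val.map f)
    (hc : Finsupp.toMultiset γ = Finset.univ.val.map c) :
    pairMon (K := K) α γ = ∑ σ : Equiv.Perm (Fin n), if f = c ∘ σ then 1 else 0 := by
  obtain ⟨e, he⟩ := exists_equiv_of_map_univ_eq _ f
    ((map_univ_toList_get (Finsupp.toMultiset α)).trans hf)
  obtain ⟨e', he'⟩ := exists_equiv_of_map_univ_eq _ c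
    ((map_univ_toList_get (Finsupp.toMultiset γ)).trans hc)
  have h : (Finsupp.toMultiset α).toList.length = (Finsupp.toMultiset γ).toList.length := by
    rw [Multiset.length_toList, Multiset.length_toList, hf, hc, Multiset.card_map,
      Multiset.card_map]
  rw [pairMon, dif_pos h]
  refine Fintype.sum_equiv (e.equivCongr ((finCongr h).trans e')) _ _ fun σ => ?_
  rw [Finset.prod_ite_zero, Finset.prod_const_one]
  have hσ : (∀ i ∈ Finset.univ, (Finsupp.toMultiset α).toList.get i
      = (Finsupp.toMultiset γ).toList.get (Fin.cast h (σ i))) ↔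
      f = c ∘ e.equivCongr ((finCongr h).trans e') σ := by
    simp only [Finset.mem_univ, true_implies, funext_iff, ← he, ← he', Function.comp_apply]
    refine ⟨fun H i => ?_, fun H i => ?_⟩
    · simpa using H (e.symm i)
    · simpa using H (e i)
  split_ifs <;> tauto

theorem iotaTensor_pow (b : Module.Basis (Fin m) K L) (n : ℕ) :
    iotaTensor b ^ n = ∑ f : Fin n → Fin m,
      MvPolynomial.monomial (∑ j, Finsupp.single (f j) 1) (1 : K) ⊗ₜ[K]
        (List.ofFn fun j => UniversalEnvelopingAlgebra.ι K (b (f j))).prod := by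
  induction n with
  | zero => simp [Algebra.TensorProduct.one_def]
  | succ n ih =>
    rw [pow_succ', ih, iotaTensor, Finset.sum_mul_sum, ← Fintype.sum_prod_type',
      ← (Fin.consEquiv fun _ => Fin m).sum_comp]
    refine Finset.sum_congr rfl fun x _ => ?_
    rw [Algebra.TensorProduct.tmul_mul_tmul, MvPolynomial.X, MvPolynomial.monomial_mul]
    simp [Fin.consEquiv, Fin.sum_univ_succ, List.ofFn_succ]

theorem pairTensor_iotaTensor_pow_monomial (b : Module.Basis (Fin m) K L) (n : ℕ)
    (γ : Fin m →₀ ℕ) :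
    pairTensor (iotaTensor b ^ n) (MvPolynomial.monomial γ 1) =
      ∑ f : Fin n → Fin m, pairMon (K := K) (∑ j, Finsupp.single (f j) 1) γ •
        (List.ofFn fun j => UniversalEnvelopingAlgebra.ι K (b (f j))).prod := by
  rw [iotaTensor_pow, map_sum, LinearMap.sum_apply]
  refine Finset.sum_congr rfl fun f _ => ?_
  rw [pairTensor, TensorProduct.lift.tmul, pairBilU, LinearMap.mk₂_apply,
    LinearMap.smulRight_apply, pairLin]
  have hb : ∀ α : Fin m →₀ ℕ, MvPolynomial.monomial α (1 : K) =
    MvPolynomial.basisMonomials (Fin m) K α := fun _ => rfl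
  rw [hb, hb, Module.Basis.constr_basis, Module.Basis.constr_basis]

theorem pairTensor_exp_monomial_of_ne (b : Module.Basis (Fin m) K L) {n : ℕ}
    {γ : Fin m →₀ ℕ} (h : n ≠ γ.degree) :
    pairTensor (((n.factorial : K))⁻¹ • iotaTensor b ^ n) (MvPolynomial.monomial γ 1) = 0 := by
  rw [map_smul, LinearMap.smul_apply, pairTensor_iotaTensor_pow_monomial,
    Finset.sum_eq_zero, smul_zero]
  intro f _
  rw [pairMon_of_degree_ne, zero_smul]
  simpa using h

theorem pairTensor_exp_monomial (b : Module.Basis (Fin m) K L) (γ : Fin m →₀ ℕ) :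
    pairTensor (((γ.degree.factorial : K))⁻¹ • iotaTensor b ^ γ.degree)
      (MvPolynomial.monomial γ 1) = symmMonomial b γ := by
  rw [map_smul, LinearMap.smul_apply, ← length_toList_toMultiset,
    pairTensor_iotaTensor_pow_monomial, symmMonomial]
  congr 1
  have key : ∀ f : Fin (Finsupp.toMultiset γ).toList.length → Fin m, _ := fun f =>
    pairMon_eq_sum_perm (K := K) (α := ∑ j, Finsupp.single (f j) 1) (γ := γ) f
      (Finsupp.toMultiset γ).toList.get
      (by
        rw [← Multiset.sum_map_singleton (Finset.univ.val.map f), Multiset.map_map,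
          Finsupp.toMultiset_sum]
        simp only [Finsupp.toMultiset_single, one_smul]
        rfl)
      (map_univ_toList_get _).symm
  simp_rw [key, Finset.sum_smul]
  rw [Finset.sum_comm]
  refine Finset.sum_congr rfl fun σ _ => ?_
  simp only [ite_smul, one_smul, zero_smul, Finset.sum_ite_eq', Finset.mem_univ, if_true,
    Function.comp_apply]

theorem linearMap_apply_eq_sum_support {M : Type*} [AddCommMonoid M] [Module K M]
    (T : MvPolynomial (Fin m) K →ₗ[K] M) (P : MvPolynomial (Fin m) K) :
    T P = ∑ α ∈ P.support, MvPolynomial.coeff α P • T (MvPolynomial.monomial α 1) := by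
  conv_lhs => rw [P.as_sum, map_sum]
  refine Finset.sum_congr rfl fun α _ => ?_
  rw [← map_smul, MvPolynomial.smul_monomial, smul_eq_mul, mul_one]

/-- Pairing with the exponential of the identity tensor is the PBW symmetrization map: for
homogeneous `P` of degree `d`, `⟨ι^d/d!, P⟩ = β(P)` and `⟨ι^e/e!, P⟩ = 0` for `e ≠ d`;
equivalently `⟨e^ι, Q⟩ = β(Q)` for all `Q`, interpreting `e^ι` degree by degree. -/
theorem pairing_exp_iota_eq_symmetrization (b : Module.Basis (Fin m) K L)
    (P : MvPolynomial (Fin m) K) (d : ℕ) (hP : P.IsHomogeneous d) :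
    pairTensor (((d.factorial : K))⁻¹ • iotaTensor b ^ d) P = symmetrization b P ∧
    (∀ e : ℕ, e ≠ d → pairTensor (((e.factorial : K))⁻¹ • iotaTensor b ^ e) P = 0) ∧
    (∀ Q : MvPolynomial (Fin m) K,
      ∑ e ∈ Finset.range (Q.totalDegree + 1),
        pairTensor (((e.factorial : K))⁻¹ • iotaTensor b ^ e) Q = symmetrization b Q) := by
  have hdeg : ∀ α ∈ P.support, α.degree = d := fun α hα => by
    rw [Finsupp.degree_eq_weight_one]
    exact hP (MvPolynomial.mem_support_iff.mp hα)
  refine ⟨?_, fun e he => ?_, fun Q => ?_⟩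
  · rw [linearMap_apply_eq_sum_support, symmetrization]
    refine Finset.sum_congr rfl fun α hα => ?_
    rw [← hdeg α hα, pairTensor_exp_monomial]
  · rw [linearMap_apply_eq_sum_support]
    refine Finset.sum_eq_zero fun α hα => ?_
    rw [pairTensor_exp_monomial_of_ne b (by rwa [hdeg α hα]), smul_zero]
  · simp_rw [linearMap_apply_eq_sum_support _ Q]
    rw [Finset.sum_comm, symmetrization]
    refine Finset.sum_congr rfl fun α hα => ?_
    rw [Finset.sum_eq_single α.degree, pairTensor_exp_monomial]
    · intro e _ he
      rw [pairTensor_exp_monomial_of_ne b he, smul_zero]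
    · intro h
      exact absurd (Finset.mem_range_succ_iff.mpr (MvPolynomial.le_totalDegree hα)) h

end
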